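/- Let n = 2, let D be a nonempty bounded open connected subset of ℝ², and let λ > 0. Suppose u is continuous on the closure of D, twice continuously differentiable on D, vanishes at every point of ∂D, and satisfies the eigenvalue equation −Δu(x) = λ u(x) for all x ∈ D. Then sup_{x∈D} |u(x)| ≤ λ · ( ln π + (1/π)(1 + ln R) + λ/(8π²) ) · ‖u‖₁, where R = (|D|/π)^{1/2}. -/

import Mathlib

open MeasureTheory Set Metric Filter

noncomputable section

abbrev Euc2 := EuclideanSpace ℝ (Fin 2)

/-- The Laplacian `Δu(x) = ∑ i, ∂²u/∂x_i²(x)` in dimension 2. -/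
def lapl (u : Euc2 → ℝ) (x : Euc2) : ℝ :=
  ∑ i : Fin 2, fderiv ℝ (fun y => fderiv ℝ u y (EuclideanSpace.single i 1)) x
    (EuclideanSpace.single i 1)

/-- The unnormalized standard Gaussian on the plane. -/
def gauss (z : Euc2) : ℝ := Real.exp (-(1 / 2) * ‖z‖ ^ 2)

theorem gauss_pos (z : Euc2) : 0 < gauss z := Real.exp_pos _

theorem gauss_le_one (z : Euc2) : gauss z ≤ 1 := by
  rw [gauss, Real.exp_le_one_iff]; nlinarith [sq_nonneg ‖z‖]

theorem contDiff_gauss : ContDiff ℝ 1 gauss := by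
  unfold gauss
  exact (contDiff_const.mul (contDiff_norm_sq ℝ)).exp

theorem fderiv_gauss (z v : Euc2) : fderiv ℝ gauss z v = -inner ℝ z v * gauss z := by
  have h : HasFDerivAt gauss _ z :=
    ((hasStrictFDerivAt_norm_sq z).hasFDerivAt.const_mul (-(1 / 2 : ℝ))).exp
  rw [h.fderiv]
  simp [gauss]
  ring

theorem integral_gauss : ∫ z, gauss z = 2 * Real.pi := by
  unfold gauss
  rw [GaussianFourier.integral_rexp_neg_mul_sq_norm (by norm_num)]
  simp
  ring

theorem integrable_gauss : Integrable gauss := by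
  by_contra h
  have := integral_gauss
  rw [integral_undef h] at this
  linarith [Real.pi_pos]

theorem integrable_norm_mul_gauss : Integrable (fun z => ‖z‖ * gauss z) := by
  have h : Integrable (fun z : Euc2 => Real.exp (-(1 / 4) * ‖z‖ ^ 2)) := by
    by_contra h
    have := GaussianFourier.integral_rexp_neg_mul_sq_norm (V := Euc2) (b := 1 / 4) (by norm_num)
    rw [integral_undef h] at this
    simp at this
  refine h.mono' (by have := contDiff_gauss.continuous; fun_prop) (.of_forall fun z => ?_)
  rw [Real.norm_of_nonneg (by have := gauss_pos z; positivity), gauss,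
    show -(1 / 2 : ℝ) * ‖z‖ ^ 2 = -(1 / 4) * ‖z‖ ^ 2 + -(1 / 4 * ‖z‖ ^ 2) by ring, Real.exp_add,
    mul_left_comm]
  refine mul_le_of_le_one_right (Real.exp_pos _).le ?_
  rw [Real.exp_neg, ← div_eq_mul_inv, div_le_one (Real.exp_pos _)]
  nlinarith [Real.add_one_le_exp (1 / 4 * ‖z‖ ^ 2), sq_nonneg (‖z‖ / 2 - 1)]

/-- Gaussian integration by parts for the radial derivative. -/
theorem integral_fderiv_mul_gauss {w : Euc2 → ℝ} (hw : ContDiff ℝ 2 w)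
    (hwc : HasCompactSupport w) (x : Euc2) (s : ℝ) :
    ∫ z, fderiv ℝ w (x + s • z) z * gauss z = s * ∫ z, lapl w (x + s • z) * gauss z := by
  have hd : ∀ v, ContDiff ℝ 1 (fun y => fderiv ℝ w y v) := fun v =>
    (hw.fderiv_right (m := 1) le_rfl).clm_apply contDiff_const
  have hdc : ∀ v, HasCompactSupport (fun y => fderiv ℝ w y v) := fun v =>
    hwc.fderiv_apply ℝ v
  have hg := contDiff_gauss.continuous
  have aff : ∀ z, HasFDerivAt (fun z : Euc2 => x + s • z) (s • ContinuousLinearMap.id ℝ Euc2) z :=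
    fun z => ((hasFDerivAt_id z).const_smul s).const_add x
  have e1 : ∀ (i : Fin 2) (z : Euc2), inner ℝ z (EuclideanSpace.single i (1 : ℝ)) = z i := by
    intro i z
    simp [EuclideanSpace.inner_single_right]
  have key : ∀ i : Fin 2,
      Integrable (fun z : Euc2 => fderiv ℝ w (x + s • z) (EuclideanSpace.single i 1) *
        (z i * gauss z)) ∧
      Integrable (fun z : Euc2 => fderiv ℝ (fun y => fderiv ℝ w y (EuclideanSpace.single i 1))
        (x + s • z) (EuclideanSpace.single i 1) * gauss z) ∧
      ∫ z : Euc2, fderiv ℝ w (x + s • z) (EuclideanSpace.single i 1) * (z i * gauss z) =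
        s * ∫ z : Euc2, fderiv ℝ (fun y => fderiv ℝ w y (EuclideanSpace.single i 1))
        (x + s • z) (EuclideanSpace.single i 1) * gauss z := by
    intro i
    set v : Euc2 := EuclideanSpace.single i 1 with hv
    have hd' := hd v
    have hdc' := hdc v
    set f : Euc2 → ℝ := fun y => fderiv ℝ w y v with hf
    have hfd : Continuous (fun y => fderiv ℝ f y v) :=
      (hd'.continuous_fderiv one_ne_zero).clm_apply continuous_const
    have hfdc : HasCompactSupport (fun y => fderiv ℝ f y v) := hdc'.fderiv_apply ℝ v
    obtain ⟨C0, hC0⟩ := hdc'.exists_bound_of_continuous hd'.continuous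
    obtain ⟨C1, hC1⟩ := hfdc.exists_bound_of_continuous hfd
    have hfs : ∀ z, HasFDerivAt (fun z => f (x + s • z))
        ((fderiv ℝ f (x + s • z)).comp (s • ContinuousLinearMap.id ℝ Euc2)) z := fun z =>
      HasFDerivAt.comp (g := f) z ((hd'.differentiable one_ne_zero (x + s • z)).hasFDerivAt) (aff z)
    have hfs' : ∀ z, fderiv ℝ (fun z => f (x + s • z)) z v = s * fderiv ℝ f (x + s • z) v := by
      intro z
      rw [(hfs z).fderiv]; simp
    have hgs : ∀ z, fderiv ℝ gauss z v = -(z i * gauss z) := fun z => by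
      rw [fderiv_gauss, e1, neg_mul]
    have hfc := hd'.continuous
    have hzg : Integrable (fun z : Euc2 => z i * gauss z) := by
      refine integrable_norm_mul_gauss.mono' (by fun_prop) (.of_forall fun z => ?_)
      rw [norm_mul, Real.norm_of_nonneg (gauss_pos z).le]
      exact mul_le_mul_of_nonneg_right (PiLp.norm_apply_le z i) (gauss_pos z).le
    have i1 : Integrable (fun z : Euc2 => f (x + s • z) * (z i * gauss z)) :=
      hzg.bdd_mul (c := C0) (by fun_prop) (.of_forall fun z => hC0 _)
    have i2 : Integrable (fun z : Euc2 => fderiv ℝ f (x + s • z) v * gauss z) :=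
      integrable_gauss.bdd_mul (c := C1) (hfd.comp (by fun_prop)).aestronglyMeasurable
        (.of_forall fun z => hC1 _)
    have i3 : Integrable (fun z : Euc2 => f (x + s • z) * gauss z) :=
      integrable_gauss.bdd_mul (c := C0) (by fun_prop) (.of_forall fun z => hC0 _)
    refine ⟨i1, i2, ?_⟩
    have ibp := integral_mul_fderiv_eq_neg_fderiv_mul_of_integrable (μ := volume)
      (f := fun z => f (x + s • z)) (g := gauss) (v := v)
      (by simp only [hfs', mul_assoc]; exact i2.const_mul s)
      (by simp only [hgs, mul_neg]; exact i1.neg) i3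
      (fun z _ => (hfs z).differentiableAt)
      (fun z _ => contDiff_gauss.differentiable one_ne_zero z)
    simp only [hfs', hgs, mul_neg, integral_neg, mul_assoc, integral_const_mul, neg_inj] at ibp
    exact ibp
  have exp1 : ∀ z, fderiv ℝ w (x + s • z) z * gauss z =
      ∑ i : Fin 2, fderiv ℝ w (x + s • z) (EuclideanSpace.single i 1) * (z i * gauss z) := by
    intro z
    have hz : z = ∑ i : Fin 2, z i • (EuclideanSpace.single i (1 : ℝ) : Euc2) := by
      ext j; fin_cases j <;> simp
    conv_lhs => rw [show fderiv ℝ w (x + s • z) z = fderiv ℝ w (x + s • z)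
      (∑ i : Fin 2, z i • (EuclideanSpace.single i (1 : ℝ) : Euc2)) by rw [← hz]]
    rw [map_sum, Finset.sum_mul]
    refine Finset.sum_congr rfl fun i _ => ?_
    rw [map_smul, smul_eq_mul]; ring
  simp only [exp1, lapl, Finset.sum_mul]
  rw [integral_finsetSum _ fun i _ => (key i).1, integral_finsetSum _ fun i _ => (key i).2.1,
    Finset.mul_sum]
  exact Finset.sum_congr rfl fun i _ => (key i).2.2

/-- Sub-mean value inequality with Gaussian weights. -/
theorem le_integral_add_of_neg_le_lapl {w : Euc2 → ℝ} (hw : ContDiff ℝ 2 w)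
    (hwc : HasCompactSupport w) (hw0 : ∀ x, 0 ≤ w x) {A : ℝ} (hA : 0 ≤ A)
    (hl : ∀ x, -A ≤ lapl w x) (x : Euc2) {r : ℝ} (hr : 0 < r) :
    w x ≤ (∫ y, w y) / (2 * Real.pi * r ^ 2) + A * r ^ 2 / 2 := by
  have hg := contDiff_gauss.continuous
  have hwcont := hw.continuous
  obtain ⟨C0, hC0⟩ := hwc.exists_bound_of_continuous hwcont
  have hfd : Continuous (fderiv ℝ w) := hw.continuous_fderiv two_ne_zero
  obtain ⟨C1, hC1⟩ := (hwc.fderiv ℝ).exists_bound_of_continuous hfd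
  have i0 : ∀ s : ℝ, Integrable (fun z : Euc2 => w (x + s • z) * gauss z) := fun s =>
    integrable_gauss.bdd_mul (c := C0) (by fun_prop) (.of_forall fun z => hC0 _)
  have hder : ∀ s : ℝ, HasDerivAt (fun s : ℝ => ∫ z, w (x + s • z) * gauss z)
      (s * ∫ z, lapl w (x + s • z) * gauss z) s := by
    intro s
    rw [← integral_fderiv_mul_gauss hw hwc]
    refine (hasDerivAt_integral_of_dominated_loc_of_deriv_le (s := univ)
      (F := fun (s : ℝ) z => w (x + s • z) * gauss z)
      (F' := fun (s : ℝ) z => fderiv ℝ w (x + s • z) z * gauss z)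
      (bound := fun z => C1 * (‖z‖ * gauss z)) univ_mem
      (.of_forall fun t => (i0 t).aestronglyMeasurable) (i0 s) ?_ ?_ ?_ ?_).2
    · exact (((hfd.comp (by fun_prop)).clm_apply continuous_id).mul hg).aestronglyMeasurable
    · refine .of_forall fun z t _ => ?_
      rw [norm_mul, Real.norm_of_nonneg (gauss_pos z).le, ← mul_assoc]
      exact mul_le_mul_of_nonneg_right ((fderiv ℝ w (x + t • z)).le_of_opNorm_le (hC1 _) z)
        (gauss_pos z).le
    · exact integrable_norm_mul_gauss.const_mul C1
    · refine .of_forall fun z t _ => HasDerivAt.mul_const ?_ _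
      have h1 : HasDerivAt (fun t : ℝ => x + t • z) z t := by
        simpa using ((hasDerivAt_id t).smul_const z).const_add x
      exact ((hw.differentiable two_ne_zero (x + t • z)).hasFDerivAt).comp_hasDerivAt t h1
  have hder2 : ∀ s : ℝ, HasDerivAt
      (fun s : ℝ => (∫ z, w (x + s • z) * gauss z) + Real.pi * A * s ^ 2)
      (s * (∫ z, lapl w (x + s • z) * gauss z) + Real.pi * A * (2 * s)) s := fun s => by
    have h := (hder s).add ((hasDerivAt_pow 2 s).const_mul (Real.pi * A))
    simp only [Nat.cast_ofNat, Nat.add_one_sub_one, pow_one] at h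
    exact h
  have hlow : ∀ s : ℝ, -(A * (2 * Real.pi)) ≤ ∫ z, lapl w (x + s • z) * gauss z := by
    intro s
    by_cases hi : Integrable (fun z => lapl w (x + s • z) * gauss z)
    · rw [← integral_gauss, ← integral_const_mul, ← integral_neg]
      refine integral_mono (integrable_gauss.const_mul A).neg hi fun z => ?_
      have := mul_le_mul_of_nonneg_right (hl (x + s • z)) (gauss_pos z).le
      simpa using this
    · rw [integral_undef hi]
      have := Real.pi_pos
      nlinarith
  have mono : MonotoneOn (fun s : ℝ => (∫ z, w (x + s • z) * gauss z) + Real.pi * A * s ^ 2)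
      (Ici 0) := by
    refine monotoneOn_of_deriv_nonneg (convex_Ici 0)
      (fun s _ => (hder2 s).continuousAt.continuousWithinAt)
      (fun s _ => (hder2 s).differentiableAt.differentiableWithinAt) fun s hs => ?_
    rw [(hder2 s).deriv]
    rw [interior_Ici] at hs
    have := mul_le_mul_of_nonneg_left (hlow s) (le_of_lt hs)
    linarith
  have h1 := mono (a := 0) (by simp) (b := r) hr.le hr.le
  simp only [zero_smul, add_zero, integral_const_mul, integral_gauss] at h1
  have h2 : ∫ z, w (x + r • z) * gauss z ≤ (r ^ 2)⁻¹ * ∫ y, w y := by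
    have hwi : Integrable w := hwcont.integrable_of_hasCompactSupport hwc
    have h3 : ∫ z, w (x + r • z) = (r ^ 2)⁻¹ * ∫ y, w y := by
      rw [Measure.integral_comp_smul volume (fun y => w (x + y)) r,
        integral_add_left_eq_self (fun y => w y) x]
      simp
    rw [← h3]
    refine integral_mono (i0 r) ((hwi.comp_add_left x).comp_smul hr.ne') fun z => ?_
    exact mul_le_of_le_one_right (hw0 _) (gauss_le_one z)
  have hpi := Real.pi_pos
  have h4 : w x * (2 * Real.pi) ≤ (r ^ 2)⁻¹ * (∫ y, w y) + Real.pi * A * r ^ 2 := by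
    simp at h1
    linarith
  rw [← le_div_iff₀ (by positivity)] at h4
  refine h4.trans_eq ?_
  field_simp

/-- The derivative of `softPos`: a smooth step from `0` at `ε` to `1` at `2ε`. -/
def softStep (ε t : ℝ) : ℝ := Real.smoothTransition ((t - ε) / ε)

/-- A smooth convex approximation of the positive part, vanishing on `(-∞, ε]`. -/
def softPos (ε t : ℝ) : ℝ := ∫ s in (0 : ℝ)..t, softStep ε s

section softPos

variable {ε : ℝ}

theorem contDiff_softStep : ContDiff ℝ 1 (softStep ε) := by
  unfold softStep
  exact (Real.smoothTransition.contDiff (n := 1)).comp ((contDiff_id.sub contDiff_const).div_const ε)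

theorem softStep_nonneg (t : ℝ) : 0 ≤ softStep ε t := Real.smoothTransition.nonneg _

theorem softStep_le_one (t : ℝ) : softStep ε t ≤ 1 := Real.smoothTransition.le_one _

theorem softStep_eq_zero (hε : 0 < ε) {t : ℝ} (ht : t ≤ ε) : softStep ε t = 0 :=
  Real.smoothTransition.zero_of_nonpos (div_nonpos_of_nonpos_of_nonneg (by linarith) hε.le)

theorem softStep_eq_one (hε : 0 < ε) {t : ℝ} (ht : 2 * ε ≤ t) : softStep ε t = 1 :=
  Real.smoothTransition.one_of_one_le (by rw [le_div_iff₀ hε]; linarith)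

theorem deriv_softStep_nonneg (hε : 0 < ε) (t : ℝ) : 0 ≤ deriv (softStep ε) t := by
  have : Monotone (softStep ε) := fun a b hab =>
    Real.smoothTransition.monotone (by gcongr)
  exact this.deriv_nonneg

theorem hasDerivAt_softPos (t : ℝ) : HasDerivAt (softPos ε) (softStep ε t) t :=
  contDiff_softStep.continuous.integral_hasStrictDerivAt 0 t |>.hasDerivAt

theorem deriv_softPos : deriv (softPos ε) = softStep ε :=
  funext fun t => (hasDerivAt_softPos t).deriv

theorem contDiff_softPos : ContDiff ℝ 2 (softPos ε) := by
  rw [show (2 : WithTop ℕ∞) = 1 + 1 from (one_add_one_eq_two).symm, contDiff_succ_iff_deriv]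
  exact ⟨fun t => (hasDerivAt_softPos t).differentiableAt, by simp,
    deriv_softPos ▸ contDiff_softStep⟩

theorem monotone_softPos : Monotone (softPos ε) :=
  monotone_of_deriv_nonneg (fun t => (hasDerivAt_softPos t).differentiableAt) fun t => by
    rw [deriv_softPos]; exact softStep_nonneg t

theorem softPos_eq_zero (hε : 0 < ε) {t : ℝ} (ht : t ≤ ε) : softPos ε t = 0 := by
  rw [softPos, intervalIntegral.integral_congr (g := fun _ => (0 : ℝ)),
    intervalIntegral.integral_zero]
  intro s hs
  exact softStep_eq_zero hε (hs.2.trans (max_le hε.le ht))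

theorem softPos_nonneg (hε : 0 < ε) (t : ℝ) : 0 ≤ softPos ε t := by
  rcases le_total t ε with h | h
  · exact (softPos_eq_zero hε h).ge
  · exact (softPos_eq_zero hε le_rfl).ge.trans (monotone_softPos h)

theorem softPos_le_abs (hε : 0 < ε) (t : ℝ) : softPos ε t ≤ |t| := by
  rcases le_total t 0 with h | h
  · rw [softPos_eq_zero hε (h.trans hε.le)]; exact abs_nonneg t
  · have : Monotone fun t => t - softPos ε t := by
      have hd : ∀ t, HasDerivAt (fun t => t - softPos ε t) (1 - softStep ε t) t := fun t =>
        (hasDerivAt_id t).sub (hasDerivAt_softPos t)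
      refine monotone_of_deriv_nonneg (fun t => (hd t).differentiableAt) fun t => ?_
      rw [(hd t).deriv]
      linarith [softStep_le_one (ε := ε) t]
    have h1 := this h
    simp only [softPos_eq_zero hε hε.le] at h1
    exact le_trans (by linarith) (le_abs_self t)

theorem sub_le_softPos (hε : 0 < ε) (t : ℝ) : t - 2 * ε ≤ softPos ε t := by
  rcases le_total t (2 * ε) with h | h
  · exact le_trans (by linarith) (softPos_nonneg hε t)
  · have hint : ∀ a b, IntervalIntegrable (softStep ε) volume a b := fun a b =>
      contDiff_softStep.continuous.intervalIntegrable a b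
    have h1 : softPos ε t = softPos ε (2 * ε) + ∫ s in (2 * ε)..t, softStep ε s :=
      (intervalIntegral.integral_add_adjacent_intervals (hint _ _) (hint _ _)).symm
    have h2 : ∫ s in (2 * ε)..t, softStep ε s = t - 2 * ε := by
      rw [intervalIntegral.integral_congr (g := fun _ => (1 : ℝ)), integral_one]
      intro s hs
      rw [uIcc_of_le h] at hs
      exact softStep_eq_one hε hs.1
    rw [h1, h2]
    linarith [softPos_nonneg hε (2 * ε)]

end softPos

theorem lapl_congr {u v : Euc2 → ℝ} {x : Euc2} (h : u =ᶠ[nhds x] v) : lapl u x = lapl v x := by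
  unfold lapl
  refine Finset.sum_congr rfl fun i _ => ?_
  have : (fun y => fderiv ℝ u y (EuclideanSpace.single i 1)) =ᶠ[nhds x]
      fun y => fderiv ℝ v y (EuclideanSpace.single i 1) := by
    filter_upwards [h.fderiv (𝕜 := ℝ)] with y hy
    rw [hy]
  rw [this.fderiv_eq]

theorem lapl_comp {D : Set Euc2} (hDo : IsOpen D) {u : Euc2 → ℝ} (hu : ContDiffOn ℝ 2 u D)
    {f : ℝ → ℝ} (hf : ContDiff ℝ 2 f) {x : Euc2} (hx : x ∈ D) :
    lapl (fun y => f (u y)) x = deriv f (u x) * lapl u x +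
      deriv (deriv f) (u x) * ∑ i : Fin 2, fderiv ℝ u x (EuclideanSpace.single i 1) ^ 2 := by
  have hud : ∀ y ∈ D, DifferentiableAt ℝ u y := fun y hy =>
    (hu.contDiffAt (hDo.mem_nhds hy)).differentiableAt two_ne_zero
  have hf1 : ContDiff ℝ 1 (deriv f) := by
    rw [show (2 : WithTop ℕ∞) = 1 + 1 from (one_add_one_eq_two).symm, contDiff_succ_iff_deriv] at hf
    exact hf.2.2
  have hfd : Differentiable ℝ f := hf.differentiable two_ne_zero
  unfold lapl
  rw [Finset.mul_sum, Finset.mul_sum, ← Finset.sum_add_distrib]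
  refine Finset.sum_congr rfl fun i _ => ?_
  set v : Euc2 := EuclideanSpace.single i 1
  have h1 : (fun y => fderiv ℝ (fun y => f (u y)) y v) =ᶠ[nhds x]
      fun y => deriv f (u y) * fderiv ℝ u y v := by
    filter_upwards [hDo.mem_nhds hx] with y hy
    have h : HasFDerivAt (fun y => f (u y)) _ y :=
      (hfd (u y)).hasDerivAt.comp_hasFDerivAt y (hud y hy).hasFDerivAt
    rw [h.fderiv]
    simp
  have h2 : DifferentiableAt ℝ (fun y => fderiv ℝ u y v) x :=
    (((hu.contDiffAt (hDo.mem_nhds hx)).fderiv_right (m := 1) le_rfl).clm_apply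
      contDiffAt_const).differentiableAt one_ne_zero
  have h3 : HasFDerivAt (fun y => deriv f (u y)) (deriv (deriv f) (u x) • fderiv ℝ u x) x :=
    (hf1.differentiable one_ne_zero (u x)).hasDerivAt.comp_hasFDerivAt x (hud x hx).hasFDerivAt
  have h4 : HasFDerivAt (fun y => deriv f (u y) * fderiv ℝ u y v) _ x := h3.mul h2.hasFDerivAt
  rw [h1.fderiv_eq, h4.fderiv]
  simp
  ring

/-- One-sided pointwise bound for an eigenfunction, obtained by applying the Gaussian sub-mean value
inequality to a smooth convex truncation extended by zero. -/
theorem eigenfunction_le {D : Set Euc2} (hDo : IsOpen D) (hDb : Bornology.IsBounded D)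
    {lam : ℝ} (hlam : 0 < lam) {u : Euc2 → ℝ} (hu_cont : ContinuousOn u (closure D))
    (hu_smooth : ContDiffOn ℝ 2 u D) (hu_bdry : ∀ x ∈ frontier D, u x = 0)
    (hu_eig : ∀ x ∈ D, -lapl u x = lam * u x) {M : ℝ} (hM : ∀ x ∈ D, |u x| ≤ M)
    {x : Euc2} (hx : x ∈ D) {r : ℝ} (hr : 0 < r) :
    u x ≤ (∫ y in D, |u y|) / (2 * Real.pi * r ^ 2) + lam * M * r ^ 2 / 2 := by
  have hcomp : IsCompact (closure D) := hDb.isCompact_closure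
  have hM0 : 0 ≤ M := (abs_nonneg _).trans (hM x hx)
  refine le_of_forall_pos_le_add fun η hη => ?_
  obtain ⟨ε, hε, rfl⟩ : ∃ ε, 0 < ε ∧ η = 2 * ε := ⟨η / 2, by positivity, by ring⟩
  set w : Euc2 → ℝ := D.indicator fun y => softPos ε (u y) with hw
  have hin : ∀ y ∈ D, w =ᶠ[nhds y] fun y => softPos ε (u y) := fun y hy => by
    filter_upwards [hDo.mem_nhds hy] with z hz
    exact indicator_of_mem hz _
  have hout : ∀ y ∉ D, w =ᶠ[nhds y] fun _ => 0 := fun y hy => by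
    by_cases hyc : y ∈ closure D
    · have hyf : y ∈ frontier D := by
        rw [hDo.frontier_eq]; exact ⟨hyc, hy⟩
      have h1 : ∀ᶠ z in nhdsWithin y (closure D), u z < ε :=
        (hu_cont y hyc).eventually (gt_mem_nhds (by rw [hu_bdry y hyf]; exact hε))
      filter_upwards [eventually_nhdsWithin_iff.1 h1] with z hz
      by_cases hzD : z ∈ D
      · rw [hw, indicator_of_mem hzD, softPos_eq_zero hε (hz (subset_closure hzD)).le]
      · exact indicator_of_notMem hzD _
    · filter_upwards [isClosed_closure.isOpen_compl.mem_nhds hyc] with z hz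
      exact indicator_of_notMem (fun h => hz (subset_closure h)) _
  have hw2 : ContDiff ℝ 2 w := by
    rw [contDiff_iff_contDiffAt]
    intro y
    by_cases hy : y ∈ D
    · exact (contDiff_softPos.contDiffAt.comp y
        (hu_smooth.contDiffAt (hDo.mem_nhds hy))).congr_of_eventuallyEq (hin y hy)
    · exact contDiffAt_const.congr_of_eventuallyEq (hout y hy)
  have hwc : HasCompactSupport w := HasCompactSupport.intro hcomp fun y hy =>
    indicator_of_notMem (fun h => hy (subset_closure h)) _
  have hw0 : ∀ y, 0 ≤ w y := fun y => indicator_nonneg (fun z _ => softPos_nonneg hε _) y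
  have hl : ∀ y, -(lam * M) ≤ lapl w y := by
    intro y
    have hlM : 0 ≤ lam * M := by positivity
    by_cases hy : y ∈ D
    · rw [lapl_congr (hin y hy), lapl_comp hDo hu_smooth contDiff_softPos hy, deriv_softPos]
      have h1 : 0 ≤ deriv (softStep ε) (u y) *
          ∑ i : Fin 2, fderiv ℝ u y (EuclideanSpace.single i 1) ^ 2 :=
        mul_nonneg (deriv_softStep_nonneg hε _) (Finset.sum_nonneg fun i _ => sq_nonneg _)
      have h2 : lapl u y = -(lam * u y) := by linarith [hu_eig y hy]
      have h3 : softStep ε (u y) * (lam * u y) ≤ lam * M := by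
        have h4 : lam * |u y| ≤ lam * M := by gcongr; exact hM y hy
        have h5 : softStep ε (u y) * (lam * u y) ≤ softStep ε (u y) * (lam * |u y|) := by
          gcongr
          · exact softStep_nonneg _
          · exact le_abs_self _
        have h6 : softStep ε (u y) * (lam * |u y|) ≤ lam * |u y| :=
          mul_le_of_le_one_left (by positivity) (softStep_le_one _)
        linarith
      rw [h2]
      linarith
    · have : lapl w y = 0 := by
        rw [lapl_congr (hout y hy)]
        simp [lapl]
      linarith
  have hmain := le_integral_add_of_neg_le_lapl hw2 hwc hw0 (by positivity) hl x hr
  have hwx : u x - 2 * ε ≤ w x := by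
    rw [hw, indicator_of_mem hx]; exact sub_le_softPos hε _
  have hui : IntegrableOn (fun y => |u y|) D :=
    (hu_cont.abs.integrableOn_compact hcomp).mono_set subset_closure
  have hint : ∫ y, w y ≤ ∫ y in D, |u y| := by
    rw [← integral_indicator hDo.measurableSet]
    refine integral_mono (hw2.continuous.integrable_of_hasCompactSupport hwc)
      (hui.integrable_indicator hDo.measurableSet) fun y => ?_
    exact indicator_le_indicator (softPos_le_abs hε _)
  have : (∫ y, w y) / (2 * Real.pi * r ^ 2) ≤ (∫ y in D, |u y|) / (2 * Real.pi * r ^ 2) := by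
    have := Real.pi_pos
    gcongr
  linarith

theorem abs_eigenfunction_le {D : Set Euc2} (hDo : IsOpen D) (hDb : Bornology.IsBounded D)
    {lam : ℝ} (hlam : 0 < lam) {u : Euc2 → ℝ} (hu_cont : ContinuousOn u (closure D))
    (hu_smooth : ContDiffOn ℝ 2 u D) (hu_bdry : ∀ x ∈ frontier D, u x = 0)
    (hu_eig : ∀ x ∈ D, -lapl u x = lam * u x) {M : ℝ} (hM : ∀ x ∈ D, |u x| ≤ M)
    {x : Euc2} (hx : x ∈ D) :
    |u x| ≤ lam * (∫ y in D, |u y|) / (2 * Real.pi) + M / 2 := by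
  have hneg : ∀ y, lapl (fun z => -u z) y = -lapl u y := fun y => by
    simp [lapl, fderiv_fun_neg, Finset.sum_neg_distrib]
  have hr : 0 < Real.sqrt (1 / lam) := by positivity
  have h1 := eigenfunction_le hDo hDb hlam hu_cont hu_smooth hu_bdry hu_eig hM hx hr
  have h2 := eigenfunction_le hDo hDb hlam (u := fun z => -u z) hu_cont.neg hu_smooth.neg
    (fun y hy => by simp [hu_bdry y hy])
    (fun y hy => by rw [hneg, hu_eig y hy]; ring) (M := M) (by simpa using hM) hx hr
  rw [Real.sq_sqrt (by positivity)] at h1 h2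
  simp only [abs_neg] at h2
  have e : (∫ y in D, |u y|) / (2 * Real.pi * (1 / lam)) + lam * M * (1 / lam) / 2 =
      lam * (∫ y in D, |u y|) / (2 * Real.pi) + M / 2 := by
    field_simp
  rw [e] at h1 h2
  exact abs_le'.2 ⟨h1, h2⟩

/-- If `λR² ≥ 1`, the constant in the eigenfunction bound is at least `1/π`. -/
theorem one_div_pi_le_const {lam R : ℝ} (hlam : 0 < lam) (hR : 0 < R) (h : 1 ≤ lam * R ^ 2) :
    1 / Real.pi ≤
      Real.log Real.pi + (1 / Real.pi) * (1 + Real.log R) + lam / (8 * Real.pi ^ 2) := by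
  have hpi := Real.pi_pos
  have h3 := Real.pi_gt_three
  have hlog : 0 ≤ Real.log lam + 2 * Real.log R := by
    have := Real.log_nonneg h
    rwa [Real.log_mul hlam.ne' (by positivity), Real.log_pow, Nat.cast_ofNat] at this
  have h1 : Real.log lam ≤ lam / (4 * Real.pi) - 1 + (2 * Real.log 2 + Real.log Real.pi) := by
    have h4 := Real.log_le_sub_one_of_pos (show 0 < lam / (4 * Real.pi) by positivity)
    rw [Real.log_div hlam.ne' (by positivity), Real.log_mul (by norm_num) hpi.ne',
      show (4 : ℝ) = 2 ^ 2 by norm_num, Real.log_pow, Nat.cast_ofNat] at h4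
    norm_num at h4
    linarith
  have h2 := Real.log_two_lt_d9
  have h5 : 1 ≤ Real.log Real.pi := by
    rw [Real.le_log_iff_exp_le hpi]
    linarith [Real.exp_one_lt_d9]
  have h6 : 0 ≤ Real.pi * Real.log Real.pi + Real.log R + lam / (8 * Real.pi) := by
    have h7 : lam / (8 * Real.pi) = lam / (4 * Real.pi) / 2 := by field_simp; norm_num
    nlinarith
  have h8 : Real.log Real.pi + (1 / Real.pi) * (1 + Real.log R) + lam / (8 * Real.pi ^ 2) =
      1 / Real.pi +
        (Real.pi * Real.log Real.pi + Real.log R + lam / (8 * Real.pi)) / Real.pi := by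
    field_simp
    ring
  rw [h8]
  have := div_nonneg h6 hpi.le
  linarith

/-- `L^∞`-`L^1` estimate for Dirichlet eigenfunctions of the Laplacian in dimension 2:
`‖u‖_∞ ≤ λ (ln π + (1/π)(1 + ln R) + λ/(8π²)) ‖u‖₁`. -/
theorem eigenfunction_linfty_bound_dim_two
    (D : Set Euc2) (hD : D.Nonempty) (hDo : IsOpen D)
    (hDb : Bornology.IsBounded D) (hDc : IsConnected D)
    (lam : ℝ) (hlam : 0 < lam)
    (u : Euc2 → ℝ)
    (hu_cont : ContinuousOn u (closure D))
    (hu_smooth : ContDiffOn ℝ 2 u D)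
    (hu_bdry : ∀ x ∈ frontier D, u x = 0)
    (hu_eig : ∀ x ∈ D, -lapl u x = lam * u x)
    (R : ℝ) (hR : R = Real.sqrt ((volume D).toReal / Real.pi)) :
    (⨆ x ∈ D, |u x|) ≤
      lam * (Real.log Real.pi + (1/Real.pi) * (1 + Real.log R) + lam / (8 * Real.pi^2)) *
        (∫ x in D, |u x|) := by
  have hcomp : IsCompact (closure D) := hDb.isCompact_closure
  have hpi := Real.pi_pos
  obtain ⟨x₀, hx₀, hmax⟩ := hcomp.exists_isMaxOn hD.closure hu_cont.abs
  have hM : ∀ x ∈ D, |u x| ≤ |u x₀| := fun x hx => hmax (subset_closure hx)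
  have hsup : (⨆ x ∈ D, |u x|) ≤ |u x₀| :=
    Real.iSup_le (fun x => Real.iSup_le (fun hx => hM x hx) (abs_nonneg _)) (abs_nonneg _)
  refine hsup.trans ?_
  rcases (abs_nonneg (u x₀)).eq_or_lt with h0 | h0
  · have : ∫ x in D, |u x| = 0 := by
      rw [setIntegral_congr_fun (g := fun _ => (0 : ℝ)) hDo.measurableSet, integral_zero]
      intro x hx
      exact le_antisymm (h0 ▸ hM x hx) (abs_nonneg _)
    rw [this, mul_zero, ← h0]
  have hx₀D : x₀ ∈ D := by
    by_contra h
    have := hu_bdry x₀ (by rw [hDo.frontier_eq]; exact ⟨hx₀, h⟩)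
    simp [this] at h0
  have hb := abs_eigenfunction_le hDo hDb hlam hu_cont hu_smooth hu_bdry hu_eig hM hx₀D
  have hfin : volume D < ⊤ := hDb.measure_lt_top
  have hvol : 0 < (volume D).toReal :=
    ENNReal.toReal_pos (hDo.measure_pos volume hD).ne' hfin.ne
  have hRpos : 0 < R := by rw [hR]; positivity
  have hR2 : Real.pi * R ^ 2 = (volume D).toReal := by
    rw [hR, Real.sq_sqrt (by positivity)]; field_simp
  have hui : IntegrableOn (fun y => |u y|) D :=
    (hu_cont.abs.integrableOn_compact hcomp).mono_set subset_closure
  have hI0 : 0 ≤ ∫ x in D, |u x| := integral_nonneg fun _ => abs_nonneg _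
  have hI : ∫ x in D, |u x| ≤ Real.pi * R ^ 2 * |u x₀| := by
    rw [hR2]
    have := setIntegral_mono_on hui (integrableOn_const hfin.ne) hDo.measurableSet hM
    simpa [Measure.real] using this
  have hb' : |u x₀| ≤ lam * (1 / Real.pi) * ∫ x in D, |u x| := by
    have : lam * (1 / Real.pi) * (∫ x in D, |u x|) =
        2 * (lam * (∫ x in D, |u x|) / (2 * Real.pi)) := by field_simp
    rw [this]; linarith
  have hlamR : 1 ≤ lam * R ^ 2 := by
    have h1 : lam * (1 / Real.pi) * (∫ x in D, |u x|) ≤ lam * R ^ 2 * |u x₀| :=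
      (mul_le_mul_of_nonneg_left hI (by positivity)).trans_eq (by field_simp)
    by_contra! h
    nlinarith
  refine hb'.trans ?_
  gcongr
  exact one_div_pi_le_const hlam hRpos hlamR
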